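/- Let D₁ be the split graph with vertex set {1,2,3,4,5,6} ∪ {a,b,c,d}, in which {1,2,3,4,5,6} induces a complete graph, {a,b,c,d} is an independent set, and the remaining edges are exactly: a adjacent to 1, 3, 5; b adjacent to 1, 2; c adjacent to 3, 4; d adjacent to 5, 6. Then the induced subgraph of D₁ obtained by deleting the clique vertex 2 is word-representable. -/

import Mathlib

/-- Two distinct letters `x` and `y` alternate in a word `w` if the subsequence of `w`
obtained by deleting all letters other than `x` and `y` has no two equal consecutive
letters (i.e. it is of the form `xyxy...` or `yxyx...`). -/
def Alternates {V : Type*} [DecidableEq V] (w : List V) (x y : V) : Prop :=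
  (w.filter fun z => decide (z = x ∨ z = y)).Chain' (· ≠ ·)

/-- `w` is a word representing the graph `G`: every vertex occurs in `w`, and two distinct
vertices alternate in `w` iff they are adjacent in `G`. -/
def WordRepresents {V : Type*} [DecidableEq V] (G : SimpleGraph V) (w : List V) : Prop :=
  (∀ v : V, v ∈ w) ∧ ∀ x y : V, x ≠ y → (Alternates w x y ↔ G.Adj x y)

/-- A graph is word-representable if some word represents it. -/
def WordRepresentable {V : Type*} [DecidableEq V] (G : SimpleGraph V) : Prop :=
  ∃ w : List V, WordRepresents G w
/-- Neighborhoods in the clique `{1,…,6}` (represented by `Fin 6`, with vertex `i+1`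
represented by `i`) of the independent vertices `a, b, c, d` (represented by `Fin 4`):
`a` is adjacent to `1,3,5`; `b` to `1,2`; `c` to `3,4`; `d` to `5,6`. -/
def D1nbr : Fin 4 → Finset (Fin 6)
  | 0 => {0, 2, 4}
  | 1 => {0, 1}
  | 2 => {2, 3}
  | 3 => {4, 5}

/-- The split graph `D₁`: the clique `{1,…,6}` (as `Fin 6`), the independent set
`{a,b,c,d}` (as `Fin 4`), and edges between them given by `D1nbr`. -/
def D1 : SimpleGraph (Fin 6 ⊕ Fin 4) :=
  SimpleGraph.fromRel fun u v =>
    match u, v with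
    | Sum.inl _, Sum.inl _ => True
    | Sum.inl i, Sum.inr a => i ∈ D1nbr a
    | _, _ => False

instance {V : Type*} [DecidableEq V] (w : List V) (x y : V) : Decidable (Alternates w x y) :=
  inferInstanceAs (Decidable (List.IsChain _ _))

instance : DecidableRel D1.Adj
  | .inl i, .inl j => decidable_of_iff (i ≠ j) (by simp [D1])
  | .inl i, .inr a => decidable_of_iff (i ∈ D1nbr a) (by simp [D1])
  | .inr a, .inl i => decidable_of_iff (i ∈ D1nbr a) (by simp [D1])
  | .inr _, .inr _ => isFalse (by simp [D1])

/-- The word `b1bc3a4d65c134cd6a5bd`, over the vertices of `D₁` other than `2`. -/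
def D1DeleteTwoWord : List {v : Fin 6 ⊕ Fin 4 | v ≠ Sum.inl 1} :=
  [⟨.inr 1, by decide⟩, ⟨.inl 0, by decide⟩, ⟨.inr 1, by decide⟩, ⟨.inr 2, by decide⟩,
    ⟨.inl 2, by decide⟩, ⟨.inr 0, by decide⟩, ⟨.inl 3, by decide⟩, ⟨.inr 3, by decide⟩,
    ⟨.inl 5, by decide⟩, ⟨.inl 4, by decide⟩, ⟨.inr 2, by decide⟩, ⟨.inl 0, by decide⟩,
    ⟨.inl 2, by decide⟩, ⟨.inl 3, by decide⟩, ⟨.inr 2, by decide⟩, ⟨.inr 3, by decide⟩,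
    ⟨.inl 5, by decide⟩, ⟨.inr 0, by decide⟩, ⟨.inl 4, by decide⟩, ⟨.inr 1, by decide⟩,
    ⟨.inr 3, by decide⟩]

/-- Deleting the vertex `2` (the clique vertex represented by `Sum.inl 1`) from `D₁` yields a word-representable graph. -/
theorem stmt14 :
    WordRepresentable (D1.induce {v : Fin 6 ⊕ Fin 4 | v ≠ Sum.inl 1}) := by
  refine ⟨D1DeleteTwoWord, ?_, fun x y hxy => ?_⟩
  · have h : ∀ v, ∃ u ∈ D1DeleteTwoWord, u = v := by decide +kernel
    simpa using h
  · rw [SimpleGraph.induce_adj]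
    revert x y
    decide +kernel
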